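/- Let L be an invertible n_L×n_L real matrix, R an invertible n_R×n_R real matrix, m ∈ ℕ, and let j_L : Fin m → Fin n_L and i_R : Fin m → Fin n_R be injective maps. Let N be the (n_L+n_R)×(n_L+n_R) block matrix N = [[L, −E_{j_L}E_{i_R}ᵀ],[0, R]]. Then ‖N‖_F ≤ ‖L‖_F + ‖R‖_F + √(min(n_L, n_R)), and ‖N⁻¹‖_F ≤ ‖L⁻¹‖_F + ‖R⁻¹‖_F + ‖L⁻¹E_{j_L}‖_F · ‖E_{i_R}ᵀR⁻¹‖_F. -/

import Mathlib

open Matrix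

/-- For an injective map `j : Fin m → Fin n`, the column-selection matrix
`E_j ∈ ℝ^{n×m}` with `(E_j)_{a,b} = 1` if `a = j b` and `0` otherwise. -/
def sel {m n : ℕ} (j : Fin m → Fin n) : Matrix (Fin n) (Fin m) ℝ :=
  fun a b => if a = j b then 1 else 0

/-- The Frobenius norm of a real matrix: the square root of the sum of the
squares of its entries. -/
noncomputable def frob {α β : Type*} [Fintype α] [Fintype β]
    (A : Matrix α β ℝ) : ℝ :=
  Real.sqrt (∑ a, ∑ b, (A a b) ^ 2)

theorem frob_mul_le {α β γ : Type*} [Fintype α] [Fintype β] [Fintype γ]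
    (A : Matrix α β ℝ) (B : Matrix β γ ℝ) : frob (A * B) ≤ frob A * frob B := by
  simpa [frob, frobenius_norm_def, Real.sqrt_eq_rpow] using frobenius_norm_mul A B

theorem frob_nonneg {α β : Type*} [Fintype α] [Fintype β] (A : Matrix α β ℝ) :
    0 ≤ frob A :=
  Real.sqrt_nonneg _

theorem frob_neg {α β : Type*} [Fintype α] [Fintype β] (A : Matrix α β ℝ) :
    frob (-A) = frob A := by
  simp [frob]

theorem frob_sq {α β : Type*} [Fintype α] [Fintype β] (A : Matrix α β ℝ) :
    frob A ^ 2 = ∑ a, ∑ b, (A a b) ^ 2 :=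
  Real.sq_sqrt (by positivity)

theorem frob_eq_sqrt_trace {α β : Type*} [Fintype α] [Fintype β] (A : Matrix α β ℝ) :
    frob A = Real.sqrt (A * Aᵀ).trace := by
  simp [frob, trace, mul_apply, sq]

theorem frob_fromBlocks_zero₂₁_le {α β γ δ : Type*} [Fintype α] [Fintype β] [Fintype γ]
    [Fintype δ] (A : Matrix α γ ℝ) (B : Matrix α δ ℝ) (D : Matrix β δ ℝ) :
    frob (fromBlocks A B 0 D) ≤ frob A + frob D + frob B := by
  have hA := frob_nonneg A
  have hB := frob_nonneg B
  have hD := frob_nonneg D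
  have h : frob (fromBlocks A B 0 D) ^ 2 = frob A ^ 2 + frob B ^ 2 + frob D ^ 2 := by
    simp [frob_sq, Fintype.sum_sum_type, Finset.sum_add_distrib, add_assoc]
  refine le_of_sq_le_sq ?_ (by positivity)
  rw [h]
  nlinarith [mul_nonneg hA hB, mul_nonneg hA hD, mul_nonneg hB hD]

theorem transpose_sel_mul_sel {m n : ℕ} {j : Fin m → Fin n} (hj : Function.Injective j) :
    (sel j)ᵀ * sel j = 1 := by
  ext a b
  simp [sel, mul_apply, one_apply, hj.eq_iff, eq_comm]

theorem frob_sel_mul_transpose_sel {m n k : ℕ} {j : Fin m → Fin n} {i : Fin m → Fin k}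
    (hj : Function.Injective j) (hi : Function.Injective i) :
    frob (sel j * (sel i)ᵀ) = Real.sqrt m := by
  rw [frob_eq_sqrt_trace, transpose_mul, transpose_transpose, Matrix.mul_assoc,
    ← Matrix.mul_assoc (sel i)ᵀ, transpose_sel_mul_sel hi, Matrix.one_mul, trace_mul_comm,
    transpose_sel_mul_sel hj, trace_one, Fintype.card_fin]

/-- **Frobenius-norm bounds for the multiplication gate.** With
`N = [[L, −E_{j_L}E_{i_R}ᵀ], [0, R]]`, one has
`‖N‖_F ≤ ‖L‖_F + ‖R‖_F + √(min n_L n_R)` and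
`‖N⁻¹‖_F ≤ ‖L⁻¹‖_F + ‖R⁻¹‖_F + ‖L⁻¹E_{j_L}‖_F * ‖E_{i_R}ᵀR⁻¹‖_F`. -/
theorem multiplication_gate_frobenius_bounds
    (nL nR m : ℕ)
    (L : Matrix (Fin nL) (Fin nL) ℝ) (R : Matrix (Fin nR) (Fin nR) ℝ)
    (hL : IsUnit L.det) (hR : IsUnit R.det)
    (jL : Fin m → Fin nL) (iR : Fin m → Fin nR)
    (hjL : Function.Injective jL) (hiR : Function.Injective iR)
    (N : Matrix (Fin nL ⊕ Fin nR) (Fin nL ⊕ Fin nR) ℝ)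
    (hN : N = Matrix.fromBlocks L (-(sel jL * (sel iR)ᵀ)) 0 R) :
    frob N ≤ frob L + frob R + Real.sqrt (min nL nR) ∧
    frob N⁻¹ ≤ frob L⁻¹ + frob R⁻¹ +
      frob (L⁻¹ * sel jL) * frob ((sel iR)ᵀ * R⁻¹) := by
  subst hN
  constructor
  · refine (frob_fromBlocks_zero₂₁_le _ _ _).trans ?_
    rw [frob_neg, frob_sel_mul_transpose_sel hjL hiR]
    gcongr
    have hmL : m ≤ nL := by simpa using Fintype.card_le_of_injective jL hjL
    have hmR : m ≤ nR := by simpa using Fintype.card_le_of_injective iR hiR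
    exact_mod_cast le_min hmL hmR
  · have hLR : IsUnit L ↔ IsUnit R :=
      iff_of_true ((isUnit_iff_isUnit_det L).mpr hL) ((isUnit_iff_isUnit_det R).mpr hR)
    rw [inv_fromBlocks_zero₂₁_of_isUnit_iff _ _ _ hLR]
    refine (frob_fromBlocks_zero₂₁_le _ _ _).trans ?_
    rw [show -(L⁻¹ * -(sel jL * (sel iR)ᵀ) * R⁻¹) =
      (L⁻¹ * sel jL) * ((sel iR)ᵀ * R⁻¹) by simp [Matrix.mul_assoc]]
    gcongr
    exact frob_mul_le _ _
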